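/- arXiv:2412.17071 — 2 statements merged into one kernel-verified Lean document; each statement's English description precedes it below -/
import Mathlib

section
/- The α-limit set is a singleton in case (c) (second assertion in the proof of Lemma 4.2): Let Φ be a semiflow on X strongly focusing monotone with respect to the k-cone C, satisfying the standing assumptions, let O⁺(x) be a precompact pseudo-ordered semiorbit, and suppose alternative (c) holds: there is an ordered invariant set B̃ ⊊ ω(x) with B̃ ∼ ω(x) and, for every z ∈ ω(x)∖B̃, α(z) ∪ ω(z) ⊆ B̃ and α(z) ⊆ E. Then for any z ∈ ω(x)∖B̃ admitting z̃ ∈ ω(x)∖B̃ with z ⇀ z̃, the α-limit set α(z) (taken along the flow extension of Φ on ω(x)) is a singleton {q} with q an equilibrium; in particular Φ_{−t}(z) → q as t → ∞. -/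
open Set Metric Filter

/-- A semiflow on `X`: continuous on `[0,∞) × X`, `Φ₀ = id`, `Φ_{s+t} = Φ_s ∘ Φ_t`. -/
structure Semiflow (X : Type*) [NormedAddCommGroup X] [NormedSpace ℝ X] where
  toFun : ℝ → X → X
  cont : ContinuousOn (fun p : ℝ × X => toFun p.1 p.2) (Set.Ici (0:ℝ) ×ˢ Set.univ)
  map_zero : ∀ x, toFun 0 x = x
  map_add : ∀ s t : ℝ, 0 ≤ s → 0 ≤ t → ∀ x, toFun (s + t) x = toFun s (toFun t x)

section Defs

variable {X : Type*} [NormedAddCommGroup X] [NormedSpace ℝ X]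

/-- A cone of rank `k`: a closed set, stable under all real scalings, containing a
`k`-dimensional subspace and no subspace of higher dimension. -/
def IsKCone (C : Set X) (k : ℕ) : Prop :=
  IsClosed C ∧ (∀ (t : ℝ) (v : X), v ∈ C → t • v ∈ C) ∧
  (∃ W : Submodule ℝ X, (W : Set X) ⊆ C ∧ Module.rank ℝ W = k) ∧
  (∀ W : Submodule ℝ X, (W : Set X) ⊆ C → Module.rank ℝ W ≤ k)

/-- `C` is `k`-solid: some `k`-dimensional subspace `W` has `W \ {0} ⊆ int C`. -/
def IsKSolid (C : Set X) (k : ℕ) : Prop :=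
  ∃ W : Submodule ℝ X, Module.rank ℝ W = k ∧ ((W : Set X) \ {0}) ⊆ interior C

/-- `C` is complemented: some closed subspace of codimension `k` meets `C` only at `0`. -/
def IsComplementedCone (C : Set X) (k : ℕ) : Prop :=
  ∃ H : Submodule ℝ X, IsClosed (H : Set X) ∧ Module.rank ℝ (X ⧸ H) = k ∧
    (H : Set X) ∩ C = {0}

/-- The positive semiorbit `O⁺(x)`. -/
def posOrbit (Φ : Semiflow X) (x : X) : Set X := {y | ∃ t, 0 ≤ t ∧ y = Φ.toFun t x}

/-- The ω-limit set `ω(x) = ⋂_{s ≥ 0} cl {Φ_t(x) : t ≥ s}`. -/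
def omegaSet (Φ : Semiflow X) (x : X) : Set X :=
  ⋂ s ∈ Set.Ici (0:ℝ), closure {y | ∃ t, s ≤ t ∧ y = Φ.toFun t x}

/-- The set of equilibria of `Φ`. -/
def equilibria (Φ : Semiflow X) : Set X := {p | ∀ t, 0 ≤ t → Φ.toFun t p = p}

/-- `S` is invariant: `Φ_t(S) = S` for all `t ≥ 0`. -/
def Invariant (Φ : Semiflow X) (S : Set X) : Prop := ∀ t, 0 ≤ t → Φ.toFun t '' S = S

/-- A set is ordered w.r.t. `C` if any two of its points are ordered. -/
def OrderedSet (C S : Set X) : Prop := ∀ x ∈ S, ∀ y ∈ S, x - y ∈ C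

/-- A set is unordered w.r.t. `C` if it is not a singleton and any two distinct points are
unordered. -/
def UnorderedSet (C S : Set X) : Prop :=
  (¬ ∃ a, S = {a}) ∧ ∀ x ∈ S, ∀ y ∈ S, x ≠ y → x - y ∉ C

/-- Two sets `A ∼ B`: every point of `A` is ordered with every point of `B`. -/
def SetsOrdered (C A B : Set X) : Prop := ∀ a ∈ A, ∀ b ∈ B, a - b ∈ C

/-- `Φ` is strongly monotone with respect to the cone `C`. -/
def StronglyMonotone (Φ : Semiflow X) (C : Set X) : Prop :=
  (∀ t, 0 ≤ t → ∀ x y : X, x - y ∈ C → Φ.toFun t x - Φ.toFun t y ∈ C) ∧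
  (∀ t, 0 < t → ∀ x y : X, x - y ∈ C → x ≠ y → Φ.toFun t x - Φ.toFun t y ∈ interior C)

/-- `O⁺(x)` is pseudo-ordered. -/
def PseudoOrdered (Φ : Semiflow X) (C : Set X) (x : X) : Prop :=
  ∃ t₁ t₂ : ℝ, 0 ≤ t₁ ∧ 0 ≤ t₂ ∧ Φ.toFun t₁ x ≠ Φ.toFun t₂ x ∧
    Φ.toFun t₁ x - Φ.toFun t₂ x ∈ C

/-- A bounded operator `R` is strongly focusing w.r.t. `C` with separation index `κ`:
`0 ∉ R(C \ {0})` and every unit vector of `RC` is at distance at least `κ` from `X \ C`. -/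
def StronglyFocusing (R : X →L[ℝ] X) (C : Set X) (κ : ℝ) : Prop :=
  (∀ v ∈ C, v ≠ 0 → R v ≠ 0) ∧
  (∀ v ∈ R '' C, ‖v‖ = 1 → ∀ u ∉ C, κ ≤ ‖v - u‖)

/-- `Φ` is strongly focusing monotone with respect to `C`, with `x`-derivative `DΦ`. -/
def StronglyFocusingMonotone (Φ : Semiflow X) (DΦ : ℝ → X → X →L[ℝ] X) (C : Set X) : Prop :=
  (∀ t, 0 ≤ t → ∀ x : X, HasFDerivAt (Φ.toFun t) (DΦ t x) x) ∧
  (∀ t, 0 ≤ t → Continuous fun x : X => DΦ t x) ∧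
  StronglyMonotone Φ C ∧
  (∀ t, 0 < t → ∀ x : X, ∀ v ∈ C, v ≠ 0 → DΦ t x v ∈ interior C) ∧
  (∀ S : Set X, IsCompact S → Invariant Φ S →
    ∃ δ > (0:ℝ), ∃ T > (0:ℝ), ∃ κ > (0:ℝ), ∀ z ∈ S, ∀ x ∈ Metric.closedBall z δ,
      ∀ y ∈ Metric.closedBall z δ, ∃ R : X →L[ℝ] X,
        StronglyFocusing R C κ ∧ R (x - y) = Φ.toFun T x - Φ.toFun T y)

/-- `ψ` is a flow extension of `Φ` on the invariant set `S`. -/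
def IsFlowExtensionOn (Φ : Semiflow X) (ψ : ℝ → X → X) (S : Set X) : Prop :=
  (∀ t, 0 ≤ t → ∀ z ∈ S, ψ t z = Φ.toFun t z) ∧
  (∀ t : ℝ, ∀ z ∈ S, ψ t z ∈ S) ∧
  (∀ s t : ℝ, ∀ z ∈ S, ψ s (ψ t z) = ψ (s + t) z) ∧
  ContinuousOn (fun p : ℝ × X => ψ p.1 p.2) (Set.univ ×ˢ S)

/-- `Φ` admits a flow extension on each ω-limit set. -/
def AdmitsFlowExtensions (Φ : Semiflow X) : Prop :=
  ∀ x : X, ∃ ψ : ℝ → X → X, IsFlowExtensionOn Φ ψ (omegaSet Φ x)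

/-- The α-limit set of `z` along the (extended) flow `ψ`. -/
def alphaSet (ψ : ℝ → X → X) (z : X) : Set X :=
  ⋂ s ∈ Set.Ici (0:ℝ), closure {y | ∃ t, s ≤ t ∧ y = ψ (-t) z}

/-- Standing assumptions: `C` is a complemented `k`-solid `k`-cone, the derivative
`D_xΦ_t` is a compact operator for all `x` and `t > 0`, and `Φ` admits a flow extension on
each ω-limit set. -/
def StandingAssumptions (Φ : Semiflow X) (DΦ : ℝ → X → X →L[ℝ] X)
    (C : Set X) (k : ℕ) : Prop :=
  IsKCone C k ∧ IsKSolid C k ∧ IsComplementedCone C k ∧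
  (∀ t, 0 < t → ∀ x : X, IsCompactOperator ⇑(DΦ t x)) ∧
  AdmitsFlowExtensions Φ

end Defs

set_option linter.unusedSectionVars false

section Focusing

variable {X : Type*} [NormedAddCommGroup X] [NormedSpace ℝ X]

/-- The vectors `v` whose distance to the complement of `C` is at least `κ * ‖v‖`. -/
def focusedCone (C : Set X) (κ : ℝ) : Set X := {v | ∀ u ∉ C, κ * ‖v‖ ≤ ‖v - u‖}

lemma isClosed_focusedCone (C : Set X) (κ : ℝ) : IsClosed (focusedCone C κ) := by
  have h : focusedCone C κ = ⋂ u ∈ Cᶜ, {v : X | κ * ‖v‖ ≤ ‖v - u‖} := by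
    ext v
    simp [focusedCone]
  rw [h]
  exact isClosed_biInter fun u _ => isClosed_le (by fun_prop) (by fun_prop)

variable {C : Set X} {κ : ℝ}

lemma smul_notMem_of_notMem (hC : ∀ (t : ℝ) (v : X), v ∈ C → t • v ∈ C) {t : ℝ} (ht : t ≠ 0)
    {v : X} (hv : v ∉ C) : t • v ∉ C := fun h => hv (by
  simpa [smul_smul, inv_mul_cancel₀ ht] using hC t⁻¹ _ h)

lemma add_mem_of_mem_focusedCone {v w : X} (hv : v ∈ focusedCone C κ) (hw : ‖w‖ < κ * ‖v‖) :
    v + w ∈ C := by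
  by_contra h
  have := hv _ h
  simp only [sub_add_cancel_left, norm_neg] at this
  linarith

lemma focusedCone_subset (hκ : 0 < κ) (h0 : (0 : X) ∈ C) : focusedCone C κ ⊆ C := by
  intro v hv
  rcases eq_or_ne v 0 with rfl | hne
  · exact h0
  · simpa using add_mem_of_mem_focusedCone (w := 0) hv (by
      have := norm_pos_iff.2 hne
      simp only [norm_zero]
      positivity)

lemma StronglyFocusing.apply_mem_focusedCone {R : X →L[ℝ] X} (hR : StronglyFocusing R C κ)
    (hC : ∀ (t : ℝ) (v : X), v ∈ C → t • v ∈ C) {v : X} (hv : v ∈ C) :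
    R v ∈ focusedCone C κ := by
  intro u hu
  rcases eq_or_ne (R v) 0 with h | h
  · simp [h]
  · have hpos := norm_pos_iff.2 h
    have := hR.2 (‖R v‖⁻¹ • R v) ⟨‖R v‖⁻¹ • v, hC _ _ hv, by simp⟩
      (by rw [norm_smul, norm_inv, norm_norm, inv_mul_cancel₀ hpos.ne'])
      (‖R v‖⁻¹ • u) (smul_notMem_of_notMem hC (inv_ne_zero hpos.ne') hu)
    rw [← smul_sub, norm_smul, norm_inv, norm_norm, ← div_eq_inv_mul, le_div_iff₀ hpos] at this
    exact this

/-- If difference quotients of `f` at `p` are given by strongly focusing operators, the derivative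
of `f` at `p` maps `C` into the focused cone. -/
lemma HasFDerivAt.apply_mem_focusedCone {f : X → X} {L : X →L[ℝ] X} {p : X}
    (hf : HasFDerivAt f L p) (hC : ∀ (t : ℝ) (v : X), v ∈ C → t • v ∈ C) {δ : ℝ} (hδ : 0 < δ)
    (hR : ∀ y ∈ closedBall p δ, ∃ R : X →L[ℝ] X,
      StronglyFocusing R C κ ∧ R (y - p) = f y - f p) {v : X} (hv : v ∈ C) :
    L v ∈ focusedCone C κ := by
  have hlim := hf.lim_real v
  refine (isClosed_focusedCone C κ).mem_of_tendsto hlim ?_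
  have hsmall : Tendsto (fun c : ℝ => p + c⁻¹ • v) atTop (nhds p) := by
    have h : Tendsto (fun c : ℝ => c⁻¹ • v) atTop (nhds ((0 : ℝ) • v)) :=
      tendsto_inv_atTop_zero.smul_const v
    simpa using h.const_add p
  filter_upwards [hsmall (closedBall_mem_nhds p hδ), eventually_gt_atTop 0] with c hc hc0
  obtain ⟨R, hRf, hRe⟩ := hR _ hc
  rw [← hRe, ← map_smul]
  exact hRf.apply_mem_focusedCone hC (by
    simpa [smul_smul, mul_inv_cancel₀ hc0.ne'] using hv)

/-- A nontrivial direction of accumulation of fixed points of `f` gives a fixed vector of the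
compact derivative. -/
lemma exists_unit_fixed_vector {f : X → X} {L : X →L[ℝ] X} {p : X}
    (hf : HasFDerivAt f L p) (hp : f p = p) (hL : IsCompactOperator L) (hCc : IsClosed C)
    (hC : ∀ (t : ℝ) (v : X), v ∈ C → t • v ∈ C)
    (hacc : ∀ ε > 0, ∃ y, y ≠ p ∧ dist y p < ε ∧ f y = y ∧ y - p ∈ C) :
    ∃ e ∈ C, ‖e‖ = 1 ∧ L e = e := by
  choose y hyne hyd hyf hyC using fun n : ℕ =>
    hacc (1 / ((n : ℝ) + 1)) Nat.one_div_pos_of_nat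
  have hylim : Tendsto y atTop (nhds p) := by
    rw [tendsto_iff_dist_tendsto_zero]
    exact squeeze_zero (fun _ => dist_nonneg) (fun n => (hyd n).le)
      tendsto_one_div_add_atTop_nhds_zero_nat
  set e : ℕ → X := fun n => ‖y n - p‖⁻¹ • (y n - p) with he
  have hnpos : ∀ n, 0 < ‖y n - p‖ := fun n => norm_pos_iff.2 (sub_ne_zero.2 (hyne n))
  have he1 : ∀ n, ‖e n‖ = 1 := fun n => by
    simp [he, norm_smul, inv_mul_cancel₀ (hnpos n).ne']
  have heC : ∀ n, e n ∈ C := fun n => hC _ _ (hyC n)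
  have hdiff : Tendsto (fun n => e n - L (e n)) atTop (nhds 0) := by
    rw [hasFDerivAt_iff_isLittleO] at hf
    have := (hf.comp_tendsto hylim).norm_norm.tendsto_div_nhds_zero
    rw [tendsto_zero_iff_norm_tendsto_zero]
    refine this.congr fun n => ?_
    simp [he, hyf, hp, norm_smul, ← smul_sub, div_eq_inv_mul]
  obtain ⟨K, hK, hKs⟩ := hL.image_closedBall_subset_compact (𝕜₁ := ℝ) (f := (L : X →ₗ[ℝ] X)) 1
  obtain ⟨a, -, φ, hφ, ha⟩ := hK.tendsto_subseq (x := fun n => L (e n))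
    fun n => hKs ⟨e n, by simp [he1], rfl⟩
  have hea : Tendsto (fun n => e (φ n)) atTop (nhds a) := by
    simpa using (hdiff.comp hφ.tendsto_atTop).add ha
  refine ⟨a, hCc.mem_of_tendsto hea (Eventually.of_forall fun n => heC _), ?_, ?_⟩
  · exact tendsto_nhds_unique hea.norm (by simp [he1])
  · exact tendsto_nhds_unique ((L.continuous.tendsto a).comp hea) ha

/-- One step of the expansion of the set of admissible coefficients. -/
lemma add_smul_apply_mem {L : X →L[ℝ] X} (hκ : 0 < κ)
    (hC : ∀ (t : ℝ) (v : X), v ∈ C → t • v ∈ C)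
    (hL : ∀ v ∈ C, L v ∈ focusedCone C κ) {e u : X} (heC : e ∈ C) (hLe : L e = e)
    (hu : L u ∉ C) {a : ℝ} (ha : ∀ s : ℝ, |s| < a → e + s • u ∈ C) {s : ℝ}
    (hs : |s| < (1 + κ ^ 2 / (1 + κ)) * a) : e + s • L u ∈ C := by
  rcases eq_or_ne s 0 with rfl | hs0
  · simpa using heC
  set lam : ℝ := 1 + κ ^ 2 / (1 + κ) with hlam
  have hlam0 : 0 < lam := by positivity
  by_contra hcon
  set r : ℝ := s / lam with hr
  have hsr : s = lam * r := by rw [hr]; field_simp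
  have hr0 : r ≠ 0 := div_ne_zero hs0 hlam0.ne'
  have hra : |r| < a := by
    rw [hr, abs_div, abs_of_pos hlam0, div_lt_iff₀ hlam0]; linarith
  have hmem : ∀ t : ℝ, |t| < a → e + t • L u ∈ focusedCone C κ := fun t ht => by
    have := hL _ (ha t ht)
    rwa [map_add, map_smul, hLe] at this
  have h1 := hmem r hra _ hcon
  have h2 := hmem (-r) (by rwa [abs_neg]) ((-(2 * r)) • L u)
    (smul_notMem_of_notMem hC (by simpa using hr0) hu)
  have e1 : e + r • L u - (e + s • L u) = (-(κ ^ 2 / (1 + κ) * r)) • L u := by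
    rw [hsr, hlam]; module
  have e2 : e + (-r) • L u - (-(2 * r)) • L u = e + r • L u := by module
  rw [e1, norm_smul, norm_neg, Real.norm_eq_abs, abs_mul, abs_of_pos (by positivity)] at h1
  rw [e2] at h2
  have h3 : 2 * |r| * ‖L u‖ ≤ ‖e + r • L u‖ + ‖e + (-r) • L u‖ := by
    calc 2 * |r| * ‖L u‖ = ‖(e + r • L u) - (e + (-r) • L u)‖ := by
          rw [show (e + r • L u) - (e + (-r) • L u) = (2 * r) • L u by module, norm_smul,
            Real.norm_eq_abs, abs_mul, abs_two]
      _ ≤ _ := norm_sub_le _ _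
  have hLu : 0 < ‖L u‖ := by
    refine norm_pos_iff.2 fun h => hu ?_
    rw [h]
    simpa using hC 0 e heC
  have hq : 0 < |r| * ‖L u‖ := mul_pos (abs_pos.2 hr0) hLu
  have h4 : κ * ‖e + r • L u‖ * (1 + κ) ≤ κ ^ 2 * (|r| * ‖L u‖) := by
    calc _ ≤ κ ^ 2 / (1 + κ) * |r| * ‖L u‖ * (1 + κ) := by gcongr
      _ = _ := by field_simp
  have h5 : 2 * κ * (|r| * ‖L u‖) ≤ ‖e + r • L u‖ * (1 + κ) := by nlinarith
  have h6 := mul_le_mul_of_nonneg_left h5 hκ.le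
  nlinarith [mul_pos (pow_pos hκ 2) hq]

lemma add_smul_pow_apply_mem {L : X →L[ℝ] X} (hκ : 0 < κ)
    (hC : ∀ (t : ℝ) (v : X), v ∈ C → t • v ∈ C)
    (hL : ∀ v ∈ C, L v ∈ focusedCone C κ) {e u : X} (heC : e ∈ C) (he1 : ‖e‖ = 1)
    (hLe : L e = e) (n : ℕ) (hu : ∀ j ≤ n, (L ^ j) u ∉ C) :
    ∀ s : ℝ, |s| < (1 + κ ^ 2 / (1 + κ)) ^ n * (κ / ‖u‖) → e + s • (L ^ n) u ∈ C := by
  induction n with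
  | zero =>
    intro s hs
    have hu0 : 0 < ‖u‖ := by
      refine norm_pos_iff.2 fun h => hu 0 le_rfl ?_
      simpa [h] using hC 0 e heC
    have heK := hL e heC
    rw [hLe] at heK
    refine add_mem_of_mem_focusedCone heK ?_
    rw [pow_zero, one_mul, lt_div_iff₀ hu0] at hs
    simpa [norm_smul, he1] using hs
  | succ n ih =>
    intro s hs
    rw [pow_succ'] at hs ⊢
    have := hu (n + 1) le_rfl
    rw [pow_succ'] at this
    exact add_smul_apply_mem hκ hC hL heC hLe this (ih fun j hj => hu j (by omega))
      (by rwa [← mul_assoc])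

lemma norm_pow_apply_le {L : X →L[ℝ] X} (hκ : 0 < κ)
    (hC : ∀ (t : ℝ) (v : X), v ∈ C → t • v ∈ C)
    (hL : ∀ v ∈ C, L v ∈ focusedCone C κ) {e u w : X} (heC : e ∈ C) (he1 : ‖e‖ = 1)
    (hLe : L e = e) (n : ℕ) (hu : u ∉ C) (hw : w ∉ C) :
    κ * ‖(L ^ (n + 1)) u‖ ≤
      2 * (1 + κ) / (κ * (1 + κ ^ 2 / (1 + κ)) ^ n) * ‖u‖ + ‖(L ^ (n + 1)) u - w‖ := by
  have h0 : (0 : X) ∈ C := by simpa using hC 0 e heC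
  have hu0 : 0 < ‖u‖ := norm_pos_iff.2 fun h => hu (h ▸ h0)
  by_cases hall : ∀ j ≤ n, (L ^ j) u ∉ C
  · set s : ℝ := (1 + κ ^ 2 / (1 + κ)) ^ n * (κ / ‖u‖) / 2 with hs
    have hs0 : 0 < s := by positivity
    have hmem := hL _ (add_smul_pow_apply_mem hκ hC hL heC he1 hLe n hall s (by
      rw [abs_of_pos hs0, hs]; linarith))
    rw [map_add, map_smul, hLe, ← mul_apply_eq_comp, ← pow_succ'] at hmem
    have h1 := hmem _ (smul_notMem_of_notMem hC hs0.ne' hw)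
    have h2 : ‖e + s • (L ^ (n + 1)) u - s • w‖ ≤ 1 + s * ‖(L ^ (n + 1)) u - w‖ := by
      rw [add_sub_assoc, ← smul_sub]
      refine (norm_add_le _ _).trans ?_
      rw [he1, norm_smul, Real.norm_eq_abs, abs_of_pos hs0]
    have h3 : s * ‖(L ^ (n + 1)) u‖ ≤ ‖e + s • (L ^ (n + 1)) u‖ + 1 := by
      have := norm_sub_le (e + s • (L ^ (n + 1)) u) e
      rwa [add_sub_cancel_left, norm_smul, Real.norm_eq_abs, abs_of_pos hs0, he1] at this
    have h4 : 2 * (1 + κ) / (κ * (1 + κ ^ 2 / (1 + κ)) ^ n) * ‖u‖ = (1 + κ) / s := by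
      rw [hs]; field_simp
    rw [h4, div_add' _ _ _ hs0.ne', le_div_iff₀ hs0]
    nlinarith [mul_le_mul_of_nonneg_left h3 hκ.le]
  · push Not at hall
    obtain ⟨j, hj, hjC⟩ := hall
    have hmem : ∀ i, (L ^ (j + 1 + i)) u ∈ focusedCone C κ := by
      intro i
      induction i with
      | zero =>
        rw [add_zero, pow_succ']
        exact hL _ hjC
      | succ i ih =>
        rw [← add_assoc, pow_succ']
        exact hL _ (focusedCone_subset hκ h0 ih)
    obtain ⟨i, rfl⟩ := Nat.exists_eq_add_of_le hj
    have := hmem i w hw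
    rw [show j + 1 + i = j + i + 1 by omega] at this
    have hp : 0 ≤ 2 * (1 + κ) / (κ * (1 + κ ^ 2 / (1 + κ)) ^ (j + i)) * ‖u‖ := by positivity
    linarith

/-- A `C¹` map is uniformly close to its linearizations along a compact set. -/
lemma IsCompact.exists_uniform_linearization {f : X → X} {f' : X → X →L[ℝ] X} {A : Set X}
    (hA : IsCompact A) (hf : ∀ x, HasFDerivAt f (f' x) x) (hf' : Continuous f') {ε : ℝ}
    (hε : 0 < ε) :
    ∃ ρ > 0, ∀ p ∈ A, ∀ x ∈ ball p ρ, ∀ y ∈ ball p ρ,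
      ‖f x - f y - f' p (x - y)‖ ≤ ε * ‖x - y‖ := by
  obtain ⟨ρ, hρ, h⟩ := Metric.mem_uniformity_dist.1
    (hA.uniformContinuousAt_of_continuousAt f' (fun a _ => hf'.continuousAt)
      (Metric.dist_mem_uniformity hε))
  refine ⟨ρ, hρ, fun p hp x hx y hy => ?_⟩
  refine (convex_ball p ρ).norm_image_sub_le_of_norm_hasFDerivWithin_le'
    (fun w _ => (hf w).hasFDerivWithinAt) (fun w hw => ?_) hy hx
  have := h (a := p) (b := w) (by rwa [dist_comm]) hp
  rw [← dist_eq_norm, dist_comm]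
  exact le_of_lt this

end Focusing

section AlphaLimit

variable {X : Type*} [NormedAddCommGroup X] [NormedSpace ℝ X]

lemma mem_alphaSet_iff_mapClusterPt {ψ : ℝ → X → X} {z p : X} :
    p ∈ alphaSet ψ z ↔ MapClusterPt p atTop fun t : ℝ => ψ (-t) z := by
  rw [mapClusterPt_iff_frequently]
  simp only [alphaSet, mem_iInter, mem_closure_iff_nhds, frequently_atTop, mem_Ici]
  constructor
  · intro h U hU s
    obtain ⟨_, hyU, t, ht, rfl⟩ := h (max s 0) (le_max_right _ _) U hU
    exact ⟨t, (le_max_left _ _).trans ht, hyU⟩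
  · intro h s _ U hU
    obtain ⟨t, ht, htU⟩ := h U hU s
    exact ⟨_, htU, t, ht, rfl⟩

/-- A cluster set of a continuous path in a compact set meets every sphere centred at one of its
points `p` that separates `p` from another of its points. -/
lemma exists_mapClusterPt_dist_eq {Y : Type*} [MetricSpace Y] {y : ℝ → Y} {K : Set Y} {p q : Y}
    (hK : IsCompact K) (hyK : ∀ t, y t ∈ K) (hy : Continuous y) (hp : MapClusterPt p atTop y)
    (hq : MapClusterPt q atTop y) {r : ℝ} (hr0 : 0 < r) (hr : r < dist q p) :
    ∃ a, MapClusterPt a atTop y ∧ dist a p = r := by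
  have hfreq : ∃ᶠ t in atTop, y t ∈ K ∩ sphere p r := by
    rw [frequently_atTop]
    intro s
    obtain ⟨t₁, ht₁, h₁⟩ := frequently_atTop.1
      (hp.frequently (p := fun w => dist w p < r) (ball_mem_nhds p hr0)) s
    obtain ⟨t₂, ht₂, h₂⟩ := frequently_atTop.1
      (hq.frequently (p := fun w => r < dist w p)
        ((isOpen_lt continuous_const (by fun_prop)).mem_nhds hr)) s
    obtain ⟨t, ht, hte⟩ := intermediate_value_uIcc (a := t₁) (b := t₂)
      (f := fun t => dist (y t) p) (by fun_prop) (mem_uIcc.2 (Or.inl ⟨h₁.le, h₂.le⟩))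
    exact ⟨t, (le_min ht₁ ht₂).trans ht.1, hyK t, hte⟩
  obtain ⟨a, ha, hac⟩ :=
    (hK.inter_right isClosed_sphere).exists_mapClusterPt_of_frequently hfreq
  exact ⟨a, hac, ha.2⟩

/-- A map into a compact set is eventually close to its set of cluster points. -/
lemma eventually_exists_mapClusterPt_dist_lt {Y : Type*} [MetricSpace Y] {y : ℝ → Y} {K : Set Y}
    (hK : IsCompact K) (hyK : ∀ t, y t ∈ K) {ρ : ℝ} (hρ : 0 < ρ) :
    ∀ᶠ t in atTop, ∃ a, MapClusterPt a atTop y ∧ dist (y t) a < ρ := by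
  by_contra h
  rw [not_eventually] at h
  obtain ⟨a, -, ha⟩ := hK.exists_mapClusterPt_of_frequently
    (h.mono fun t _ => hyK t : ∃ᶠ t in atTop, y t ∈ K)
  obtain ⟨b, hb, hbc⟩ := (hK.diff (isOpen_thickening (δ := ρ)
      (E := {a | MapClusterPt a atTop y}))).exists_mapClusterPt_of_frequently
    (h.mono fun t ht => ⟨hyK t, fun hmem => ht (by
      obtain ⟨a, ha, had⟩ := mem_thickening_iff.1 hmem
      exact ⟨a, ha, had⟩)⟩ : ∃ᶠ t in atTop, y t ∈ K \ thickening ρ {a | MapClusterPt a atTop y})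
  exact hb.2 (self_subset_thickening hρ _ hbc)

/-- Two paths in a compact set whose differences avoid `C`, and whose distinct cluster points differ
by elements of the interior of `C`, are asymptotic. -/
lemma tendsto_dist_zero_of_sub_notMem {y w : ℝ → X} {K C : Set X} (hK : IsCompact K)
    (hyK : ∀ t, y t ∈ K) (hwK : ∀ t, w t ∈ K) (hyw : ∀ᶠ t in atTop, y t - w t ∉ C)
    (hint : ∀ p q, MapClusterPt p atTop y → MapClusterPt q atTop w → p ≠ q →
      p - q ∈ interior C) :
    Tendsto (fun t => dist (y t) (w t)) atTop (nhds 0) := by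
  rw [Metric.tendsto_nhds]
  intro ε hε
  by_contra h
  rw [not_eventually] at h
  have hcl : IsClosed {a : X × X | ε ≤ dist a.1 a.2} :=
    isClosed_le (by fun_prop) (by fun_prop)
  obtain ⟨⟨p, q⟩, ⟨-, hpq⟩, hc⟩ := ((hK.prod hK).inter_right hcl).exists_mapClusterPt_of_frequently
    (h.mono fun t ht => ⟨⟨hyK t, hwK t⟩, by simpa using ht⟩ :
      ∃ᶠ t in atTop, (y t, w t) ∈ (K ×ˢ K) ∩ {a : X × X | ε ≤ dist a.1 a.2})
  have hp : MapClusterPt p atTop y := hc.tendsto_comp (f := Prod.fst)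
    (continuous_fst.tendsto (p, q))
  have hq : MapClusterPt q atTop w := hc.tendsto_comp (f := Prod.snd)
    (continuous_snd.tendsto (p, q))
  have hne : p ≠ q := by
    rintro rfl
    simp only [mem_ofPred_eq, dist_self] at hpq
    linarith
  have hsub : MapClusterPt (p - q) atTop fun t => y t - w t :=
    hc.tendsto_comp (f := fun a : X × X => a.1 - a.2)
      ((continuous_fst.sub continuous_snd).tendsto (p, q))
  have hfr := hsub.frequently (mem_interior_iff_mem_nhds.1 (hint p q hp hq hne))
  obtain ⟨t, h1, h2⟩ := (hfr.and_eventually hyw).exists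
  exact h2 h1

lemma not_tendsto_zero_of_le_half {a : ℝ → ℝ} {τ : ℝ} (hτ : 0 < τ) (ha : ∀ᶠ t in atTop, 0 < a t)
    (hstep : ∀ᶠ t in atTop, a t ≤ a (t + τ) / 2) : ¬ Tendsto a atTop (nhds 0) := by
  intro hlim
  obtain ⟨s, hs⟩ := eventually_atTop.1 (ha.and hstep)
  have hmono : ∀ n : ℕ, a s ≤ a (s + n * τ) := by
    intro n
    induction n with
    | zero => simp
    | succ n ih =>
      have h := hs (s + n * τ) (le_add_of_nonneg_right (by positivity))
      have h1 : s + (n + 1 : ℕ) * τ = s + n * τ + τ := by push_cast; ring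
      rw [h1]
      linarith
  have hseq : Tendsto (fun n : ℕ => a (s + n * τ)) atTop (nhds 0) :=
    hlim.comp (tendsto_atTop_add_const_left _ s
      (tendsto_natCast_atTop_atTop.atTop_mul_const hτ))
  have := ge_of_tendsto' hseq hmono
  linarith [(hs s le_rfl).1]

lemma isCompact_omegaSet {Φ : Semiflow X} {x : X} (hpre : IsCompact (closure (posOrbit Φ x))) :
    IsCompact (omegaSet Φ x) := by
  refine hpre.of_isClosed_subset (isClosed_biInter fun _ _ => isClosed_closure) ?_
  exact biInter_subset_of_mem (mem_Ici.2 le_rfl)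

lemma IsFlowExtensionOn.zero_apply {Φ : Semiflow X} {ψ : ℝ → X → X} {S : Set X}
    (hψ : IsFlowExtensionOn Φ ψ S) {z : X} (hz : z ∈ S) : ψ 0 z = z := by
  rw [hψ.1 0 le_rfl z hz, Φ.map_zero]

lemma IsFlowExtensionOn.toFun_apply_neg {Φ : Semiflow X} {ψ : ℝ → X → X} {S : Set X}
    (hψ : IsFlowExtensionOn Φ ψ S) {z : X} (hz : z ∈ S) {s : ℝ} (hs : 0 ≤ s) (t : ℝ) :
    Φ.toFun s (ψ (-(t + s)) z) = ψ (-t) z := by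
  rw [← hψ.1 s hs _ (hψ.2.1 _ z hz), hψ.2.2.1 _ _ z hz]
  congr 1
  ring

lemma IsFlowExtensionOn.invariant {Φ : Semiflow X} {ψ : ℝ → X → X} {S : Set X}
    (hψ : IsFlowExtensionOn Φ ψ S) : Invariant Φ S := by
  intro t ht
  ext z
  constructor
  · rintro ⟨w, hw, rfl⟩
    rw [← hψ.1 t ht w hw]
    exact hψ.2.1 t w hw
  · intro hz
    refine ⟨ψ (-(0 + t)) z, hψ.2.1 _ z hz, ?_⟩
    rw [hψ.toFun_apply_neg hz ht, neg_zero, hψ.zero_apply hz]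

lemma IsFlowExtensionOn.continuous_neg {Φ : Semiflow X} {ψ : ℝ → X → X} {S : Set X}
    (hψ : IsFlowExtensionOn Φ ψ S) {z : X} (hz : z ∈ S) : Continuous fun t => ψ (-t) z :=
  hψ.2.2.2.comp_continuous (f := fun t : ℝ => (-t, z)) (by fun_prop) fun _ => ⟨mem_univ _, hz⟩

lemma Semiflow.toFun_nat_mul (Φ : Semiflow X) {T : ℝ} (hT : 0 ≤ T) (n : ℕ) :
    Φ.toFun (n * T) = (Φ.toFun T)^[n] := by
  induction n with
  | zero => ext y; simp [Φ.map_zero]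
  | succ n ih =>
    ext y
    rw [Function.iterate_succ_apply', ← ih, ← Φ.map_add T _ hT (by positivity)]
    congr 1
    push_cast
    ring

/-- Along a compact set of equilibria, each of which carries a fixed vector of the derivative in
`C`, unordered differences near the set are contracted at a suitable time. -/
lemma exists_uniform_contraction {Φ : Semiflow X} {DΦ : ℝ → X → X →L[ℝ] X} {C A : Set X}
    {T κ : ℝ} (hT : 0 < T) (hκ : 0 < κ) (hA : IsCompact A) (hAE : A ⊆ equilibria Φ)
    (hD : ∀ t, 0 ≤ t → ∀ x : X, HasFDerivAt (Φ.toFun t) (DΦ t x) x)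
    (hDc : ∀ t, 0 ≤ t → Continuous fun x : X => DΦ t x)
    (hC : ∀ (t : ℝ) (v : X), v ∈ C → t • v ∈ C)
    (hL : ∀ p ∈ A, ∀ v ∈ C, DΦ T p v ∈ focusedCone C κ)
    (he : ∀ p ∈ A, ∃ e ∈ C, ‖e‖ = 1 ∧ DΦ T p e = e) :
    ∃ τ > 0, ∃ ρ > 0, ∀ p ∈ A, ∀ y ∈ ball p ρ, ∀ w ∈ ball p ρ, y - w ∉ C →
      Φ.toFun τ y - Φ.toFun τ w ∉ C →
      ‖Φ.toFun τ y - Φ.toFun τ w‖ ≤ ‖y - w‖ / 2 := by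
  set lam : ℝ := 1 + κ ^ 2 / (1 + κ) with hlam
  have hlam1 : 1 < lam := lt_add_of_pos_right _ (by positivity)
  obtain ⟨n, hn⟩ := pow_unbounded_of_one_lt (8 * (1 + κ) / κ ^ 2) hlam1
  have hcoef : 2 * (1 + κ) / (κ * lam ^ n) ≤ κ / 4 := by
    rw [div_lt_iff₀ (by positivity)] at hn
    rw [div_le_iff₀ (by positivity)]
    nlinarith
  have hτ : 0 < ((n + 1 : ℕ) : ℝ) * T := by positivity
  obtain ⟨ρ, hρ, hlin⟩ := hA.exists_uniform_linearization (hD _ hτ.le) (hDc _ hτ.le)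
    (ε := κ / (4 * (1 + κ))) (by positivity)
  refine ⟨_, hτ, ρ, hρ, fun p hp y hy w hw hyw hΦyw => ?_⟩
  obtain ⟨e, heC, he1, hLe⟩ := he p hp
  have hDpow : DΦ ((n + 1 : ℕ) * T) p = (DΦ T p) ^ (n + 1) := by
    have h := (hD T hT.le p).iterate (hAE hp T hT.le) (n + 1)
    rw [← Φ.toFun_nat_mul hT.le] at h
    exact (hD _ hτ.le p).unique h
  have h1 := hlin p hp y hy w hw
  rw [hDpow] at h1
  have h2 := norm_pow_apply_le hκ hC (hL p hp) heC he1 hLe n hyw hΦyw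
  rw [norm_sub_rev (_ : X) (Φ.toFun _ y - _)] at h2
  set a := ‖Φ.toFun ((n + 1 : ℕ) * T) y - Φ.toFun ((n + 1 : ℕ) * T) w -
    (DΦ T p ^ (n + 1)) (y - w)‖
  set b := ‖(DΦ T p ^ (n + 1)) (y - w)‖
  have h3 : ‖Φ.toFun ((n + 1 : ℕ) * T) y - Φ.toFun ((n + 1 : ℕ) * T) w‖ ≤ a + b := by
    have h := norm_add_le (Φ.toFun ((n + 1 : ℕ) * T) y - Φ.toFun ((n + 1 : ℕ) * T) w -
      (DΦ T p ^ (n + 1)) (y - w)) ((DΦ T p ^ (n + 1)) (y - w))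
    rwa [sub_add_cancel] at h
  have h4 : κ * b ≤ κ / 4 * ‖y - w‖ + a :=
    h2.trans (by gcongr)
  have h5 : (1 + κ) * a ≤ κ / 4 * ‖y - w‖ := by
    calc (1 + κ) * a ≤ (1 + κ) * (κ / (4 * (1 + κ)) * ‖y - w‖) := by gcongr
      _ = _ := by field_simp
  refine h3.trans (le_of_mul_le_mul_left ?_ hκ)
  linarith

end AlphaLimit

/-- **The α-limit set is a singleton in case (c)** (second assertion in the proof of
Lemma 4.2). Under alternative (c), for any `z ∈ ω(x) \ B` admitting `z̃ ∈ ω(x) \ B`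
with `z ⇀ z̃`, the α-limit set `α(z)` (along the flow extension on `ω(x)`) is a
singleton `{q}` with `q` an equilibrium; in particular `Φ_{-t}(z) → q` as `t → ∞`. -/
theorem alpha_limit_singleton
    {X : Type*} [NormedAddCommGroup X] [NormedSpace ℝ X] [CompleteSpace X]
    (Φ : Semiflow X) (DΦ : ℝ → X → X →L[ℝ] X) (C : Set X) (k : ℕ) (hk : 1 ≤ k)
    (hSA : StandingAssumptions Φ DΦ C k)
    (hSFM : StronglyFocusingMonotone Φ DΦ C)
    (x : X) (hpre : IsCompact (closure (posOrbit Φ x)))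
    (hpo : PseudoOrdered Φ C x)
    (ψ : ℝ → X → X) (hψ : IsFlowExtensionOn Φ ψ (omegaSet Φ x))
    (B : Set X) (hBsub : B ⊆ omegaSet Φ x) (hBne : B ≠ omegaSet Φ x)
    (hBord : OrderedSet C B) (hBinv : Invariant Φ B)
    (hBom : SetsOrdered C B (omegaSet Φ x))
    (hc : ∀ z ∈ omegaSet Φ x \ B,
      alphaSet ψ z ∪ omegaSet Φ z ⊆ B ∧ alphaSet ψ z ⊆ equilibria Φ) :
    ∀ z ∈ omegaSet Φ x \ B, (∃ zt ∈ omegaSet Φ x \ B, z - zt ∉ C) →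
      ∃ q ∈ equilibria Φ, alphaSet ψ z = {q} ∧
        Filter.Tendsto (fun t : ℝ => ψ (-t) z) Filter.atTop (nhds q) := by
  rintro z hz ⟨zt, hzt, hzzt⟩
  obtain ⟨⟨hCc, hC, -⟩, -, -, hcomp, -⟩ := hSA
  obtain ⟨hD, hDc, ⟨hmono, hsmono⟩, -, hfoc⟩ := hSFM
  have hK := isCompact_omegaSet hpre
  obtain ⟨δ, hδ, T, hT, κ, hκ, hR⟩ := hfoc _ hK hψ.invariant
  have hyK : ∀ t : ℝ, ψ (-t) z ∈ omegaSet Φ x := fun t => hψ.2.1 _ z hz.1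
  have hwK : ∀ t : ℝ, ψ (-t) zt ∈ omegaSet Φ x := fun t => hψ.2.1 _ zt hzt.1
  have hAE : alphaSet ψ z ⊆ equilibria Φ := (hc z hz).2
  have hAB : alphaSet ψ z ⊆ B := subset_union_left.trans (hc z hz).1
  have hyw : ∀ t : ℝ, 0 ≤ t → ψ (-t) z - ψ (-t) zt ∉ C := by
    intro t ht hmem
    have h := hmono t ht _ _ hmem
    have h1 := hψ.toFun_apply_neg hz.1 ht 0
    have h2 := hψ.toFun_apply_neg hzt.1 ht 0
    rw [zero_add, neg_zero, hψ.zero_apply hz.1] at h1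
    rw [zero_add, neg_zero, hψ.zero_apply hzt.1] at h2
    rw [h1, h2] at h
    exact hzzt h
  have hdist : Tendsto (fun t : ℝ => dist (ψ (-t) z) (ψ (-t) zt)) atTop (nhds 0) := by
    refine tendsto_dist_zero_of_sub_notMem (C := C) hK hyK hwK
      ((eventually_ge_atTop 0).mono hyw) fun p q hp hq hpq => ?_
    have hp' := mem_alphaSet_iff_mapClusterPt.2 hp
    have hq' := mem_alphaSet_iff_mapClusterPt.2 hq
    have h := hsmono 1 one_pos p q
      (hBom p (hAB hp') q (hBsub ((hc zt hzt).1 (Or.inl hq')))) hpq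
    rwa [hAE hp' 1 zero_le_one, (hc zt hzt).2 hq' 1 zero_le_one] at h
  have hsub : (alphaSet ψ z).Subsingleton := by
    rw [← not_nontrivial_iff]
    intro hnt
    have hA : IsCompact (alphaSet ψ z) := hK.of_isClosed_subset
      (isClosed_biInter fun _ _ => isClosed_closure) (hAB.trans hBsub)
    have hL : ∀ p ∈ alphaSet ψ z, ∀ v ∈ C, DΦ T p v ∈ focusedCone C κ := fun p hp v hv =>
      (hD T hT.le p).apply_mem_focusedCone hC hδ (fun y hy =>
        hR p (hBsub (hAB hp)) y hy p (mem_closedBall_self hδ.le)) hv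
    have he : ∀ p ∈ alphaSet ψ z, ∃ e ∈ C, ‖e‖ = 1 ∧ DΦ T p e = e := by
      intro p hp
      refine exists_unit_fixed_vector (hD T hT.le p) (hAE hp T hT.le) (hcomp T hT p) hCc hC
        fun ε hε => ?_
      obtain ⟨q, hq, hqp⟩ := hnt.exists_ne p
      have hqp' := dist_pos.2 hqp
      obtain ⟨a, ha, hap⟩ := exists_mapClusterPt_dist_eq hK hyK (hψ.continuous_neg hz.1)
        (mem_alphaSet_iff_mapClusterPt.1 hp) (mem_alphaSet_iff_mapClusterPt.1 hq)
        (r := min (ε / 2) (dist q p / 2)) (by positivity)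
        ((min_le_right _ _).trans_lt (half_lt_self hqp'))
      have ha' := mem_alphaSet_iff_mapClusterPt.2 ha
      refine ⟨a, dist_pos.1 (hap ▸ by positivity), ?_, hAE ha' T hT.le,
        hBord a (hAB ha') p (hAB hp)⟩
      rw [hap]
      exact (min_le_left _ _).trans_lt (half_lt_self hε)
    obtain ⟨τ, hτ, ρ, hρ, hcon⟩ := exists_uniform_contraction hT hκ hA hAE hD hDc hC hL he
    refine not_tendsto_zero_of_le_half hτ ?_ ?_ hdist
    · filter_upwards [eventually_ge_atTop 0] with t ht
      refine dist_pos.2 fun h => hyw t ht ?_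
      obtain ⟨e, he', -⟩ := he _ hnt.nonempty.some_mem
      simpa [h] using hC 0 e he'
    · have hclose := eventually_exists_mapClusterPt_dist_lt hK hyK (half_pos hρ)
      have hev := (tendsto_atTop_add_const_right atTop τ tendsto_id).eventually
        (hclose.and (hdist.eventually (gt_mem_nhds (half_pos hρ))))
      filter_upwards [hev, eventually_ge_atTop 0] with t ht ht0
      obtain ⟨⟨p, hp, hpd⟩, hd⟩ := ht
      simp only [id] at hpd hd
      have h := hcon p (mem_alphaSet_iff_mapClusterPt.2 hp) (ψ (-(t + τ)) z)
        (mem_ball.2 (by linarith)) (ψ (-(t + τ)) zt)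
        (mem_ball.2 (by
          have := dist_triangle_left (ψ (-(t + τ)) zt) p (ψ (-(t + τ)) z)
          linarith))
        (hyw _ (by linarith))
      rw [hψ.toFun_apply_neg hz.1 hτ.le, hψ.toFun_apply_neg hzt.1 hτ.le] at h
      simpa only [dist_eq_norm] using h (hyw t ht0)
  obtain ⟨q, -, hq⟩ := hK.exists_mapClusterPt_of_frequently
    (Frequently.of_forall hyK : ∃ᶠ t : ℝ in atTop, ψ (-t) z ∈ omegaSet Φ x)
  have hqA := mem_alphaSet_iff_mapClusterPt.2 hq
  exact ⟨q, hAE hqA, hsub.eq_singleton_of_mem hqA,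
    hK.tendsto_nhds_of_unique_mapClusterPt (Eventually.of_forall hyK) fun a _ ha =>
      hsub (mem_alphaSet_iff_mapClusterPt.2 ha) hqA⟩
end

section
/- Spectral domination of the complementary bundle at an equilibrium (intermediate claim in the proof of Lemma 3.3): Let X be a real Banach space, let A : X → X be a bounded linear operator, and let X = E ⊕ F be a direct-sum decomposition into closed subspaces with dim E = k < ∞, A(E) = E (so A|_E is invertible on E), and A(F) ⊆ F. Suppose there exist M > 0 and 0 < γ < 1 such that ‖Aⁿw‖ ≤ Mγⁿ‖Aⁿv‖ for all n ∈ ℕ and all unit vectors w ∈ F, v ∈ E. Then for every complex eigenvalue λ of A|_E (i.e., of the complexification of A|_E), the spectral radius r(A|_F) = lim_{n→∞} ‖(A|_F)ⁿ‖^{1/n} satisfies r(A|_F) ≤ γ|λ|; equivalently, r(A|_F) · r((A|_E)^{−1}) ≤ γ < 1. -/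
/-- If `‖S w‖ * ‖T u‖ ≤ C * ‖w‖ * ‖u‖` pointwise, the product of operator norms is at most `C`. -/
theorem opNorm_mul_opNorm_le {V W : Type*} [NormedAddCommGroup V] [NormedSpace ℝ V]
    [NormedAddCommGroup W] [NormedSpace ℝ W] (S : V →L[ℝ] V) (T : W →L[ℝ] W) {C : ℝ}
    (hC : 0 ≤ C) (h : ∀ w u, ‖S w‖ * ‖T u‖ ≤ C * ‖w‖ * ‖u‖) : ‖S‖ * ‖T‖ ≤ C := by
  have hS (u : W) : ‖S‖ * ‖T u‖ ≤ C * ‖u‖ := by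
    have : ‖‖T u‖ • S‖ ≤ C * ‖u‖ :=
      ContinuousLinearMap.opNorm_le_bound _ (by positivity) fun w ↦ by
        simpa [norm_smul, mul_comm, mul_left_comm, mul_assoc] using h w u
    simpa [norm_smul, mul_comm] using this
  have : ‖‖S‖ • T‖ ≤ C :=
    ContinuousLinearMap.opNorm_le_bound _ hC fun u ↦ by simpa [norm_smul] using hS u
  simpa [norm_smul] using this

/-- If `a n * b n ≤ M * γ ^ n`, the limits of the `n`-th roots of `a` and `b` multiply to at
most `γ`. -/
theorem mul_le_of_tendsto_nthRoot {a b : ℕ → ℝ} (ha : ∀ n, 0 ≤ a n) (hb : ∀ n, 0 ≤ b n)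
    {M γ r s : ℝ} (hM : 0 < M) (hγ : 0 ≤ γ) (hab : ∀ n, a n * b n ≤ M * γ ^ n)
    (hr : Filter.Tendsto (fun n : ℕ => a n ^ ((n : ℝ)⁻¹)) Filter.atTop (nhds r))
    (hs : Filter.Tendsto (fun n : ℕ => b n ^ ((n : ℝ)⁻¹)) Filter.atTop (nhds s)) :
    r * s ≤ γ := by
  have hroot : Filter.Tendsto (fun n : ℕ => M ^ ((n : ℝ)⁻¹) * γ) Filter.atTop (nhds γ) := by
    have hinv : Filter.Tendsto (fun n : ℕ => ((n : ℝ)⁻¹)) Filter.atTop (nhds 0) :=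
      tendsto_inv_atTop_nhds_zero_nat
    simpa using ((tendsto_const_nhds (x := M)).rpow hinv (Or.inl hM.ne')).mul_const γ
  refine le_of_tendsto_of_tendsto (hr.mul hs) hroot ?_
  filter_upwards [Filter.eventually_ne_atTop 0] with n hn
  rw [← Real.mul_rpow (ha n) (hb n)]
  calc (a n * b n) ^ ((n : ℝ)⁻¹) ≤ (M * γ ^ n) ^ ((n : ℝ)⁻¹) :=
        Real.rpow_le_rpow (mul_nonneg (ha n) (hb n)) (hab n) (by positivity)
    _ = M ^ ((n : ℝ)⁻¹) * γ := by
        rw [Real.mul_rpow hM.le (by positivity), Real.pow_rpow_inv_natCast hγ hn]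

/-- Powers of a restriction of `A` to a subspace act as powers of `A`. -/
theorem coe_pow_apply_of_coe_apply {X : Type*} [NormedAddCommGroup X] [NormedSpace ℝ X]
    {G : Submodule ℝ X} {A : X →L[ℝ] X} {T : G →L[ℝ] G} (hT : ∀ v : G, (T v : X) = A v)
    (n : ℕ) (v : G) : ((T ^ n) v : X) = (A ^ n) v := by
  induction n with
  | zero => simp
  | succ n ih => rw [pow_succ', pow_succ', mul_apply_eq_comp, mul_apply_eq_comp, hT, ih]

/-- A norm estimate on unit vectors extends to all vectors by homogeneity. -/
theorem norm_apply_mul_norm_le_of_unit {X : Type*} [NormedAddCommGroup X] [NormedSpace ℝ X]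
    {E F : Submodule ℝ X} {B : X →L[ℝ] X} {C : ℝ}
    (h : ∀ w ∈ F, ‖w‖ = 1 → ∀ v ∈ E, ‖v‖ = 1 → ‖B w‖ ≤ C * ‖B v‖)
    {w v : X} (hw : w ∈ F) (hv : v ∈ E) : ‖B w‖ * ‖v‖ ≤ C * ‖w‖ * ‖B v‖ := by
  rcases eq_or_ne w 0 with rfl | hw0
  · simp
  rcases eq_or_ne v 0 with rfl | hv0
  · simp
  have key := h (‖w‖⁻¹ • w) (F.smul_mem _ hw) (by simp [norm_smul, hw0])
    (‖v‖⁻¹ • v) (E.smul_mem _ hv) (by simp [norm_smul, hv0])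
  have hwp := norm_pos_iff.2 hw0
  have hvp := norm_pos_iff.2 hv0
  simp only [map_smul, norm_smul, norm_inv, norm_norm] at key
  field_simp at key
  linarith


/-- **Spectral domination of the complementary bundle at an equilibrium** (intermediate
claim in the proof of Lemma 3.3). Let `X = E ⊕ F` with `dim E = k < ∞`, `A(E) = E`,
`A(F) ⊆ F`, and suppose `‖Aⁿ w‖ ≤ M γⁿ ‖Aⁿ v‖` for all `n` and unit `w ∈ F`, `v ∈ E`,
where `0 < γ < 1`. Then, with `A|_F : F → F` and `B_E = (A|_E)⁻¹ : E → E`, the spectral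
radii computed via Gelfand's formula `r(·) = lim ‖(·)ⁿ‖^{1/n}` satisfy
`r(A|_F) · r((A|_E)⁻¹) ≤ γ`; equivalently `r(A|_F) ≤ γ|λ|` for every complex eigenvalue
`λ` of `A|_E`. -/
theorem spectral_domination
    {X : Type*} [NormedAddCommGroup X] [NormedSpace ℝ X] [CompleteSpace X]
    (E F : Submodule ℝ X) (hEc : IsClosed (E : Set X)) (hFc : IsClosed (F : Set X))
    (hcompl : IsCompl E F) (k : ℕ) (hk : 0 < k)
    [FiniteDimensional ℝ E] (hkE : Module.finrank ℝ E = k)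
    (A : X →L[ℝ] X)
    (hAE : Submodule.map (A : X →ₗ[ℝ] X) E = E)
    (hAF : ∀ v ∈ F, A v ∈ F)
    (M γ : ℝ) (hM : 0 < M) (hγ0 : 0 < γ) (hγ1 : γ < 1)
    (hdom : ∀ n : ℕ, ∀ w ∈ F, ‖w‖ = 1 → ∀ v ∈ E, ‖v‖ = 1 →
      ‖(A ^ n) w‖ ≤ M * γ ^ n * ‖(A ^ n) v‖)
    (AE : E →L[ℝ] E) (hAEdef : ∀ v : E, (AE v : X) = A v)
    (AF : F →L[ℝ] F) (hAFdef : ∀ v : F, (AF v : X) = A v)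
    (BE : E →L[ℝ] E)
    (hBE₁ : AE.comp BE = ContinuousLinearMap.id ℝ E)
    (hBE₂ : BE.comp AE = ContinuousLinearMap.id ℝ E)
    (rF rE : ℝ)
    (hrF : Filter.Tendsto (fun n : ℕ => ‖AF ^ n‖ ^ ((n : ℝ)⁻¹)) Filter.atTop (nhds rF))
    (hrE : Filter.Tendsto (fun n : ℕ => ‖BE ^ n‖ ^ ((n : ℝ)⁻¹)) Filter.atTop (nhds rE)) :
    rF * rE ≤ γ := by
  refine mul_le_of_tendsto_nthRoot (fun n ↦ norm_nonneg (AF ^ n)) (fun n ↦ norm_nonneg (BE ^ n))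
    hM hγ0.le (fun n ↦ ?_) hrF hrE
  refine opNorm_mul_opNorm_le _ _ (by positivity) fun w u ↦ ?_
  have hcomm : Commute AE BE := hBE₁.trans hBE₂.symm
  have hAB : AE ^ n * BE ^ n = 1 := by
    rw [← hcomm.mul_pow, show AE * BE = 1 from hBE₁, one_pow]
  have hu : (A ^ n) ((BE ^ n) u : E) = (u : X) := by
    rw [← coe_pow_apply_of_coe_apply hAEdef, ← mul_apply_eq_comp, hAB,
      one_apply_eq_self]
  have key := norm_apply_mul_norm_le_of_unit (hdom n) w.2 ((BE ^ n) u).2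
  rwa [hu, ← coe_pow_apply_of_coe_apply hAFdef] at key
end
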